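/- arXiv:1409.1511 — 5 statements merged into one kernel-verified Lean document; each statement's English description precedes it below -/
import Mathlib

section
/- Let τ ∈ ℝ with τ ≠ 0. Suppose there exist positive real numbers c₁, H₁ and ω such that |Nτ − M| ≥ c₁/N^ω for all integers M, N with N ≥ H₁. Then there exist positive real numbers c₃ and H₃ (depending only on τ, ω, c₁ and H₁) such that |N(1/τ) − M| ≥ c₃/N^ω for all integers M, N with N ≥ H₃. -/
/-- A lower bound on `|N * τ - M|` for large positive `N` holds for `N` of either sign. -/
theorem abs_int_mul_sub_ge_of_pos {τ c H ω : ℝ}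
    (h : ∀ M N : ℤ, (N : ℝ) ≥ H → |(N : ℝ) * τ - (M : ℝ)| ≥ c / (N : ℝ) ^ ω)
    (M N : ℤ) (hN : H ≤ |(N : ℝ)|) :
    c / |(N : ℝ)| ^ ω ≤ |(N : ℝ) * τ - (M : ℝ)| := by
  rcases abs_choice (N : ℝ) with hs | hs
  · rw [hs] at hN ⊢
    exact h M N hN
  · rw [hs] at hN ⊢
    have := h (-M) (-N) (by push_cast; exact hN)
    push_cast at this
    rwa [show -(N : ℝ) * τ - -(M : ℝ) = -((N : ℝ) * τ - M) by ring, abs_neg] at this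

/-- irrationality measure lower bounds are preserved under
`τ ↦ 1/τ` for nonzero real `τ`. -/
theorem irrationality_measure_inverse
    (τ : ℝ) (hτ : τ ≠ 0)
    (c₁ H₁ ω : ℝ) (hc₁ : 0 < c₁) (hH₁ : 0 < H₁) (hω : 0 < ω)
    (h : ∀ M N : ℤ, (N : ℝ) ≥ H₁ → |(N : ℝ) * τ - (M : ℝ)| ≥ c₁ / (N : ℝ) ^ ω) :
    ∃ c₃ > (0:ℝ), ∃ H₃ > (0:ℝ), ∀ M N : ℤ, (N : ℝ) ≥ H₃ →
      |(N : ℝ) * (1 / τ) - (M : ℝ)| ≥ c₃ / (N : ℝ) ^ ω := by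
  have hT : 0 < |τ| := abs_pos.mpr hτ
  refine ⟨min (1 / (2 * |τ|)) (c₁ / (|τ| * (3 / (2 * |τ|)) ^ ω)), by positivity,
    max 1 (2 * |τ| * H₁), by positivity, fun M N hN => ?_⟩
  have hN1 : (1 : ℝ) ≤ N := (le_max_left _ _).trans hN
  have hN2 : 2 * |τ| * H₁ ≤ N := (le_max_right _ _).trans hN
  have hN0 : (0 : ℝ) < N := by linarith
  have hfrac : |(N : ℝ) * (1 / τ)| = 2 * (N / (2 * |τ|)) := by
    rw [abs_mul, abs_div, abs_one, abs_of_pos hN0]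
    field_simp
  rcases le_or_gt (N / (2 * |τ|)) |(N : ℝ) * (1 / τ) - M| with hD | hD
  · calc _ ≤ 1 / (2 * |τ|) / (N : ℝ) ^ ω := by gcongr; exact min_le_left _ _
      _ ≤ 1 / (2 * |τ|) := div_le_self (by positivity) (Real.one_le_rpow hN1 hω.le)
      _ ≤ N / (2 * |τ|) := by gcongr
      _ ≤ _ := hD
  · have hlow : N / (2 * |τ|) ≤ |(M : ℝ)| := by
      have := abs_sub_abs_le_abs_sub ((N : ℝ) * (1 / τ)) M
      linarith
    have hupp : |(M : ℝ)| ≤ 3 / (2 * |τ|) * N := by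
      have := abs_sub_abs_le_abs_sub (M : ℝ) ((N : ℝ) * (1 / τ))
      rw [abs_sub_comm] at this
      have : 3 / (2 * |τ|) * N = 3 * (N / (2 * |τ|)) := by ring
      linarith
    have hH : H₁ ≤ |(M : ℝ)| := by
      refine le_trans ?_ hlow
      rw [le_div_iff₀ (by positivity)]
      linarith
    have hM : 0 < |(M : ℝ)| := hH₁.trans_le hH
    have hscale : |(M : ℝ) * τ - N| = |τ| * |(N : ℝ) * (1 / τ) - M| := by
      rw [abs_sub_comm, ← abs_mul]
      congr 1
      field_simp
    calc _ ≤ c₁ / (|τ| * (3 / (2 * |τ|)) ^ ω) / (N : ℝ) ^ ω := by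
          gcongr; exact min_le_right _ _
      _ = c₁ / (3 / (2 * |τ|) * N) ^ ω / |τ| := by
          rw [Real.mul_rpow (by positivity) hN0.le, div_div, div_div]
          congr 1
          ring
      _ ≤ c₁ / |(M : ℝ)| ^ ω / |τ| := by gcongr
      _ ≤ |(M : ℝ) * τ - N| / |τ| := by
          gcongr
          exact abs_int_mul_sub_ge_of_pos h N M hH
      _ = _ := by rw [hscale, mul_div_cancel_left₀ _ hT.ne']
end

section
/- Let (a_n)_{n≥1} and (b_n)_{n≥1} be sequences of positive integers and suppose that Π_{k+1}/(B_k B_{k+1}) → 0 as k → ∞. Then the generalized continued fraction K_{n=1}^∞ a_n/b_n converges to a real number τ, and for every n ≥ 0 one has 0 < b_{n+2}Π_{n+1}/B_{n+2} < |B_nτ − A_n| < Π_{n+1}/B_{n+1}. -/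
open Filter

/-- Numerators of the convergents of the generalized continued fraction
`K_{n=1}^∞ a n / b n` (the values `a 0`, `b 0` are irrelevant). -/
def cfA (a b : ℕ → ℤ) : ℕ → ℤ
  | 0 => 0
  | 1 => a 1
  | (n + 2) => b (n + 2) * cfA a b (n + 1) + a (n + 2) * cfA a b n

/-- Denominators of the convergents of the generalized continued fraction
`K_{n=1}^∞ a n / b n`. -/
def cfB (a b : ℕ → ℤ) : ℕ → ℤ
  | 0 => 1
  | 1 => b 1
  | (n + 2) => b (n + 2) * cfB a b (n + 1) + a (n + 2) * cfB a b n

/-- `Π n = a 1 * a 2 * ⋯ * a n`. -/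
def cfPi (a : ℕ → ℤ) (n : ℕ) : ℤ := ∏ k ∈ Finset.Icc 1 n, a k

theorem cfB_pos {a b : ℕ → ℤ} (ha : ∀ n, 1 ≤ n → 0 < a n) (hb : ∀ n, 1 ≤ n → 0 < b n) (n : ℕ) :
    0 < cfB a b n := by
  induction n using Nat.twoStepInduction with
  | zero => simp [cfB]
  | one => simpa [cfB] using hb 1 le_rfl
  | more n ih₀ ih₁ =>
    rw [cfB]
    have := ha (n + 2) (by omega)
    have := hb (n + 2) (by omega)
    positivity

theorem cfPi_pos {a : ℕ → ℤ} (ha : ∀ n, 1 ≤ n → 0 < a n) (n : ℕ) : 0 < cfPi a n :=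
  Finset.prod_pos fun k hk => ha k (Finset.mem_Icc.1 hk).1

theorem cfPi_succ (a : ℕ → ℤ) (n : ℕ) : cfPi a (n + 1) = cfPi a n * a (n + 1) :=
  Finset.prod_Icc_succ_top (by omega) a

/-- The determinant formula for consecutive convergents. -/
theorem cfA_succ_mul_cfB_sub (a b : ℕ → ℤ) (n : ℕ) :
    cfA a b (n + 1) * cfB a b n - cfA a b n * cfB a b (n + 1) = (-1) ^ n * cfPi a (n + 1) := by
  induction n with
  | zero => simp [cfA, cfB, cfPi]
  | succ n ih =>
    rw [cfPi_succ, cfA, cfB, pow_succ]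
    linear_combination (-a (n + 2)) * ih

/-- A sequence with `c (n + 1) = c n + (-1) ^ n * d n`, where `d` decreases strictly to zero,
converges, and its `n`-th term lies on the side of the limit given by the sign of `(-1) ^ n`. -/
theorem exists_tendsto_of_alternating {c d : ℕ → ℝ} (hc : ∀ n, c (n + 1) = c n + (-1) ^ n * d n)
    (hd : ∀ n, d (n + 1) < d n) (hlim : Tendsto d atTop (nhds 0)) :
    ∃ τ, Tendsto c atTop (nhds τ) ∧ ∀ n, (-1) ^ n * c n < (-1) ^ n * τ := by
  obtain ⟨l, hl⟩ :=
    (strictAnti_nat_of_succ_lt hd).antitone.tendsto_alternating_series_of_tendsto_zero hlim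
  have hsum (n : ℕ) : c n = ∑ i ∈ Finset.range n, (-1) ^ i * d i + c 0 := by
    induction n with
    | zero => simp
    | succ n ih => rw [Finset.sum_range_succ, hc, ih]; ring
  have hτ : Tendsto c atTop (nhds (l + c 0)) := by
    rw [funext hsum]
    simpa using hl.add_const (c 0)
  refine ⟨l + c 0, hτ, fun n => ?_⟩
  have hmono : StrictMono fun k => (-1) ^ n * c (n + 2 * k) := by
    refine strictMono_nat_of_lt_succ fun k => ?_
    have hs : ((-1 : ℝ) ^ n) * (-1) ^ n = 1 := by rw [← mul_pow]; simp
    have hk : ((-1 : ℝ) ^ (n + 2 * k)) = (-1) ^ n := by rw [pow_add, pow_mul]; simp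
    have h := hd (n + 2 * k)
    rw [show n + 2 * (k + 1) = n + 2 * k + 1 + 1 by ring, hc, hc, pow_succ, hk]
    linear_combination h + (d (n + 2 * k + 1) - d (n + 2 * k)) * hs
  have ht : Tendsto (fun k => (-1) ^ n * c (n + 2 * k)) atTop (nhds ((-1) ^ n * (l + c 0))) :=
    (hτ.comp (tendsto_atTop_mono (fun k => by simp only [id]; omega) tendsto_id)).const_mul _
  calc (-1) ^ n * c n < (-1) ^ n * c (n + 2 * 1) := hmono zero_lt_one
    _ ≤ _ := hmono.monotone.ge_of_tendsto ht 1

/-- if `Π_{k+1}/(B_k B_{k+1}) → 0`, then the generalized continued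
fraction converges to some `τ` and `0 < b_{n+2} Π_{n+1} / B_{n+2} < |B_n τ - A_n|
< Π_{n+1} / B_{n+1}` for all `n ≥ 0`. -/
theorem gcf_converges_and_error_bounds
    (a b : ℕ → ℤ) (ha : ∀ n, 1 ≤ n → 0 < a n) (hb : ∀ n, 1 ≤ n → 0 < b n)
    (hlim : Tendsto (fun k => (cfPi a (k + 1) : ℝ) / ((cfB a b k : ℝ) * (cfB a b (k + 1) : ℝ)))
      atTop (nhds 0)) :
    ∃ τ : ℝ,
      Tendsto (fun n => (cfA a b n : ℝ) / (cfB a b n : ℝ)) atTop (nhds τ) ∧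
      ∀ n : ℕ,
        0 < (b (n + 2) : ℝ) * (cfPi a (n + 1) : ℝ) / (cfB a b (n + 2) : ℝ) ∧
        (b (n + 2) : ℝ) * (cfPi a (n + 1) : ℝ) / (cfB a b (n + 2) : ℝ)
          < |(cfB a b n : ℝ) * τ - (cfA a b n : ℝ)| ∧
        |(cfB a b n : ℝ) * τ - (cfA a b n : ℝ)| < (cfPi a (n + 1) : ℝ) / (cfB a b (n + 1) : ℝ) := by
  have hB (n : ℕ) : (0 : ℝ) < cfB a b n := by exact_mod_cast cfB_pos ha hb n
  have hP (n : ℕ) : (0 : ℝ) < cfPi a n := by exact_mod_cast cfPi_pos ha n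
  have hb' (n : ℕ) : (0 : ℝ) < b (n + 2) := by exact_mod_cast hb (n + 2) (by omega)
  have hBrec (n : ℕ) :
      (cfB a b (n + 2) : ℝ) = b (n + 2) * cfB a b (n + 1) + a (n + 2) * cfB a b n := by
    rw [cfB]; push_cast; ring
  have hc (n : ℕ) : (cfA a b (n + 1) : ℝ) / cfB a b (n + 1) = cfA a b n / cfB a b n +
      (-1) ^ n * (cfPi a (n + 1) / (cfB a b n * cfB a b (n + 1))) := by
    have h : (cfA a b (n + 1) : ℝ) * cfB a b n - cfA a b n * cfB a b (n + 1) =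
        (-1) ^ n * cfPi a (n + 1) := by exact_mod_cast cfA_succ_mul_cfB_sub a b n
    have := (hB n).ne'
    have := (hB (n + 1)).ne'
    field_simp
    linear_combination h
  have hdiff (n : ℕ) : (cfPi a (n + 1) : ℝ) / (cfB a b n * cfB a b (n + 1)) -
      cfPi a (n + 2) / (cfB a b (n + 1) * cfB a b (n + 2)) =
      b (n + 2) * cfPi a (n + 1) / cfB a b (n + 2) / cfB a b n := by
    have := (hB n).ne'
    have := (hB (n + 1)).ne'
    have := (hB (n + 2)).ne'
    rw [cfPi_succ a (n + 1)]
    push_cast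
    field_simp
    linear_combination (cfPi a (n + 1) : ℝ) * hBrec n
  have he (n : ℕ) : (0 : ℝ) < b (n + 2) * cfPi a (n + 1) / cfB a b (n + 2) :=
    div_pos (mul_pos (hb' n) (hP _)) (hB _)
  obtain ⟨τ, hτ, hside⟩ := exists_tendsto_of_alternating
    (c := fun n => (cfA a b n : ℝ) / cfB a b n) hc
    (fun n => sub_pos.1 ((div_pos (he n) (hB n)).trans_eq (hdiff n).symm)) hlim
  refine ⟨τ, hτ, fun n => ⟨he n, ?_⟩⟩
  have hs : ((-1 : ℝ) ^ n) * (-1) ^ n = 1 := by rw [← mul_pow]; simp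
  have h₀ := hside n
  have h₁ := hside (n + 1)
  have h₂ := hside (n + 2)
  simp only [hc, pow_succ] at h₀ h₁ h₂
  have hx : |(cfB a b n : ℝ) * τ - cfA a b n| =
      cfB a b n * ((-1) ^ n * (τ - cfA a b n / cfB a b n)) := by
    have hfac : (cfB a b n : ℝ) * τ - cfA a b n = cfB a b n * (τ - cfA a b n / cfB a b n) := by
      have := (hB n).ne'
      field_simp
    rw [hfac, abs_mul, abs_of_pos (hB n), ← abs_of_pos (show
      0 < (-1) ^ n * (τ - (cfA a b n : ℝ) / cfB a b n) by linarith), abs_mul]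
    simp
  rw [hx]
  constructor
  · rw [← div_lt_iff₀' (hB n), ← hdiff n]
    linear_combination h₂ - (cfPi a (n + 1) / (cfB a b n * cfB a b (n + 1)) -
      cfPi a (n + 2) / (cfB a b (n + 1) * cfB a b (n + 2)) : ℝ) * hs
  · rw [← lt_div_iff₀' (hB n), div_div, mul_comm (cfB a b (n + 1) : ℝ)]
    linear_combination h₁ + (cfPi a (n + 1) / (cfB a b n * cfB a b (n + 1)) : ℝ) * hs
end

section
/- For every positive integer k and every real number x ≥ 0, the finite continued fraction with all partial denominators equal to 1 and partial numerators given by the list (2, 2, …, 2 [2k times], 1, 1, 1, 1, 2, 2, …, 2 [2k times], x), i.e. 2/(1 + 2/(1 + ⋯ + x/1)), equals the finite continued fraction 1/(1 + 1/((7·4^k − 4)/3 + 1/(1 + 1/(1 + x)))). -/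
/-- Finite continued fraction with the given list of partial numerators and all
partial denominators equal to `1`:
`fcf [a₁, …, a_m] = a₁/(1 + a₂/(1 + ⋯ + a_m/1))`. -/
noncomputable def fcf : List ℝ → ℝ
  | [] => 0
  | a :: rest => a / (1 + fcf rest)

/-- Prepending `2k` partial numerators `2` acts on the value of the tail as the `2k`-th iterate of
`t ↦ 2 / (1 + t)`, a Möbius map with fixed points `1` and `-2`. -/
theorem fcf_replicate_two_append (k : ℕ) (l : List ℝ) (hl : 0 ≤ fcf l) :
    fcf (List.replicate (2 * k) (2 : ℝ) ++ l)
      = (((4 : ℝ) ^ k + 2) * fcf l + 2 * ((4 : ℝ) ^ k - 1))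
        / (((4 : ℝ) ^ k - 1) * fcf l + (2 * (4 : ℝ) ^ k + 1)) := by
  induction k with
  | zero => norm_num
  | succ k ih =>
    have hq : (1 : ℝ) ≤ 4 ^ k := one_le_pow₀ (by norm_num)
    rw [show 2 * (k + 1) = 2 * k + 1 + 1 by ring, List.replicate_succ, List.replicate_succ,
      List.cons_append, List.cons_append, fcf, fcf, ih, pow_succ]
    generalize (4 : ℝ) ^ k = q at hq
    generalize fcf l = t at hl
    obtain ⟨r, rfl⟩ : ∃ r, q = r + 1 := ⟨q - 1, by ring⟩
    have hr : 0 ≤ r := by linarith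
    rw [add_sub_cancel_right, show r + 1 + 2 = r + 3 by ring,
      show 2 * (r + 1) + 1 = 2 * r + 3 by ring, show (r + 1) * 4 - 1 = 4 * r + 3 by ring]
    field_simp
    ring

/-- the identity
`2/1 + ⋯ + 2/1 (2k times) + 1/1 + 1/1 + 1/1 + 1/1 + 2/1 + ⋯ + 2/1 (2k times) + x/1
 = 1/(1 + 1/((7·4^k - 4)/3 + 1/(1 + 1/(1 + x))))` for all `k ≥ 1` and `x ≥ 0`. -/
theorem gcf_ones_twos_block_identity (k : ℕ) (hk : 1 ≤ k) (x : ℝ) (hx : 0 ≤ x) :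
    fcf (List.replicate (2 * k) (2 : ℝ) ++ [1, 1, 1, 1]
        ++ List.replicate (2 * k) (2 : ℝ) ++ [x])
      = 1 / (1 + 1 / ((7 * (4 : ℝ) ^ k - 4) / 3 + 1 / (1 + 1 / (1 + x)))) := by
  have hfx : fcf [x] = x := by simp [fcf]
  have htail := fcf_replicate_two_append k [x] (hfx.symm ▸ hx)
  rw [hfx] at htail
  have hq : (1 : ℝ) ≤ 4 ^ k := one_le_pow₀ (by norm_num)
  obtain ⟨r, hr⟩ : ∃ r, (4 : ℝ) ^ k = r + 1 := ⟨4 ^ k - 1, by ring⟩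
  have hr₀ : 0 ≤ r := by linarith
  have hones : fcf ([1, 1, 1, 1] ++ (List.replicate (2 * k) (2 : ℝ) ++ [x]))
      = ((3 * r + 2 * (r + 3)) * x + (3 * (2 * r + 3) + 4 * r))
        / ((5 * r + 3 * (r + 3)) * x + (5 * (2 * r + 3) + 6 * r)) := by
    simp only [List.cons_append, List.nil_append, fcf, htail, hr]
    rw [add_sub_cancel_right, show r + 1 + 2 = r + 3 by ring,
      show 2 * (r + 1) + 1 = 2 * r + 3 by ring]
    field_simp
    ring
  rw [List.append_assoc, List.append_assoc, fcf_replicate_two_append k _ (hones ▸ by positivity),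
    hones, hr, add_sub_cancel_right, show r + 1 + 2 = r + 3 by ring,
    show 2 * (r + 1) + 1 = 2 * r + 3 by ring, show 7 * (r + 1) - 4 = 7 * r + 3 by ring]
  field_simp
  ring
end

section
/- For every nonzero integer x and every positive integer y, the asymptotic irrationality exponent of e^{x/y} equals 2, i.e., μ_I(e^{x/y}) = 2. -/
/-- The asymptotic irrationality exponent: the infimum (in `EReal`, so that the
infimum of the empty set is `∞`) of all real `μ` for which there exist `c > 0`
and `N₀ > 0` with `|τ - M/N| ≥ c / N ^ μ` for all integers `M, N` with `N ≥ N₀`. -/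
noncomputable def muI (τ : ℝ) : EReal :=
  sInf ((fun μ : ℝ => (μ : EReal)) ''
    {μ : ℝ | ∃ c > (0:ℝ), ∃ N₀ > (0:ℝ), ∀ M N : ℤ,
      (N : ℝ) ≥ N₀ → |τ - (M : ℝ) / (N : ℝ)| ≥ c / (N : ℝ) ^ μ})

open Nat in
/-- If the integer linear forms `A n * τ - B n` decay like the inverse of the size of their
coefficients, up to exponential factors, and consecutive forms are linearly independent, then the
irrationality exponent of `τ` is at most `2`. -/
theorem exists_div_rpow_le_abs_sub_div {τ K : ℝ} {A B : ℕ → ℤ} (hK : 1 ≤ K)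
    (hA : ∀ n, |(A n : ℝ)| ≤ K ^ (n + 1) * n !)
    (hAB : ∀ n, |A n * τ - B n| ≤ K ^ (n + 1) / n !)
    (hdet : ∀ n, A n * B (n + 1) - A (n + 1) * B n ≠ 0) {ε : ℝ} (hε : 0 < ε) :
    ∃ c > (0 : ℝ), ∀ M N : ℤ, 0 < N → c / (N : ℝ) ^ (2 + ε) ≤ |τ - M / N| := by
  have hK0 : 0 < K := by linarith
  set L : ℝ := K ^ 2 * 4 with hL
  have hL0 : 0 < L := by positivity
  set H : ℝ := L ^ (ε⁻¹) * K with hH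
  have hH0 : 0 < H := by positivity
  set d : ℝ := Real.exp (-H) / (2 * K ^ 2) with hd
  have hd0 : 0 < d := by positivity
  refine ⟨d ^ ε / (16 * K ^ 5), by positivity, fun M N hN => ?_⟩
  have hN1 : (1 : ℝ) ≤ N := by exact_mod_cast hN
  have hN0 : (0 : ℝ) < N := by linarith
  have hex : ∃ n : ℕ, 2 * N * (K ^ (n + 2) / n !) < 1 := by
    have h := (FloorSemiring.tendsto_pow_div_factorial_atTop K).const_mul (2 * N * K ^ 2)
    rw [mul_zero] at h
    obtain ⟨n, hn⟩ := (h.eventually (gt_mem_nhds one_pos)).exists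
    refine ⟨n, lt_of_eq_of_lt ?_ hn⟩
    ring
  obtain ⟨n, hn, hmin⟩ : ∃ n : ℕ, 2 * N * (K ^ (n + 3) / (n + 1)!) < 1 ∧
      1 ≤ 2 * N * (K ^ (n + 2) / n !) := by
    classical
    have h0 : Nat.find hex ≠ 0 := by
      intro h
      have := Nat.find_spec hex
      rw [h] at this
      have h2 : 1 ≤ K ^ 2 := one_le_pow₀ hK
      simp at this
      nlinarith
    obtain ⟨n, hn⟩ := Nat.exists_eq_succ_of_ne_zero h0
    refine ⟨n, ?_, ?_⟩
    · have := Nat.find_spec hex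
      rw [hn] at this
      exact this
    · exact not_lt.mp (Nat.find_min hex (by omega : n < Nat.find hex))
  obtain ⟨k, hk1, hk2, hk⟩ : ∃ k, n + 1 ≤ k ∧ k ≤ n + 2 ∧ B k * N - A k * M ≠ 0 := by
    by_contra! h
    have h1 := h (n + 1) le_rfl (by omega)
    have h2 := h (n + 2) (by omega) le_rfl
    have : (A (n + 1) * B (n + 1 + 1) - A (n + 1 + 1) * B (n + 1)) * N = 0 := by
      linear_combination A (n + 1) * h2 - A (n + 2) * h1
    rcases mul_eq_zero.mp this with h | h
    · exact hdet _ h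
    · omega
  have hfac : (0 : ℝ) < n ! := by positivity
  have hform : |A k * τ - B k| ≤ K ^ (n + 3) / (n + 1)! := by
    refine (hAB k).trans ?_
    gcongr ?_ / ?_
    · exact pow_le_pow_right₀ hK (by omega)
    · exact_mod_cast Nat.factorial_le hk1
  have hcoef : |(A k : ℝ)| ≤ K ^ (n + 3) * (n + 2)! := by
    refine (hA k).trans ?_
    gcongr ?_ * ?_
    · exact pow_le_pow_right₀ hK (by omega)
    · exact_mod_cast Nat.factorial_le hk2
  set δ : ℝ := |τ - M / N| with hδ
  have hδ0 : 0 ≤ δ := abs_nonneg _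
  have hone : 1 ≤ N * |A k * τ - B k| + |(A k : ℝ)| * (N * δ) := by
    have h1 : (1 : ℝ) ≤ |(B k * N - A k * M : ℝ)| := by
      exact_mod_cast Int.one_le_abs hk
    have h2 : (B k * N - A k * M : ℝ) = -(N * (A k * τ - B k)) + A k * (N * (τ - M / N)) := by
      field_simp
      ring
    rw [h2] at h1
    refine h1.trans ((abs_add_le _ _).trans_eq ?_)
    rw [abs_neg, abs_mul, abs_mul, abs_mul, abs_of_pos hN0]
  have hhalf : 1 / 2 ≤ K ^ (n + 3) * (n + 2)! * (N * δ) := by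
    have h1 : N * |A k * τ - B k| ≤ N * (K ^ (n + 3) / (n + 1)!) := by gcongr
    have h2 : |(A k : ℝ)| * (N * δ) ≤ K ^ (n + 3) * (n + 2)! * (N * δ) := by gcongr
    linarith
  have hfacN : (n ! : ℝ) ≤ 2 * N * K ^ (n + 2) := by
    rw [← mul_div_assoc, le_div_iff₀ hfac] at hmin
    linarith
  have hpoly : ((n + 2 : ℝ) * (n + 1)) ≤ 2 * 4 ^ n := by
    clear * -
    induction n with
    | zero => norm_num
    | succ n ih => push_cast; rw [pow_succ]; nlinarith [(Nat.cast_nonneg n : (0 : ℝ) ≤ n)]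
  have hLN : d ^ ε * L ^ n ≤ (N : ℝ) ^ ε := by
    have h1 : H ^ n * Real.exp (-H) ≤ n ! := by
      have := Real.pow_div_factorial_le_exp H hH0.le n
      rw [div_le_iff₀ hfac] at this
      rw [Real.exp_neg, ← div_eq_mul_inv, div_le_iff₀ (Real.exp_pos _)]
      linarith
    have h2 : d * (L ^ ε⁻¹) ^ n ≤ N := by
      have h3 := h1.trans hfacN
      have hKn : 0 < 2 * K ^ (n + 2) := by positivity
      refine le_of_mul_le_mul_right ?_ hKn
      calc d * (L ^ ε⁻¹) ^ n * (2 * K ^ (n + 2)) = H ^ n * Real.exp (-H) := by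
            rw [hd, hH, mul_pow]; field_simp; ring
        _ ≤ _ := by linarith
    calc d ^ ε * L ^ n = (d * (L ^ ε⁻¹) ^ n) ^ ε := by
          rw [Real.mul_rpow hd0.le (by positivity), ← Real.rpow_natCast (L ^ ε⁻¹),
            ← Real.rpow_mul hL0.le, ← Real.rpow_mul hL0.le, ← Real.rpow_natCast]
          congr 2
          field_simp
      _ ≤ _ := Real.rpow_le_rpow (by positivity) h2 hε.le
  have hsize : K ^ (n + 3) * (n + 2)! ≤ 4 * K ^ 5 * L ^ n * N := by
    calc K ^ (n + 3) * ((n + 2)! : ℝ) = K ^ (n + 3) * ((n + 2 : ℝ) * (n + 1) * n !) := by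
          rw [Nat.factorial_succ, Nat.factorial_succ]; push_cast; ring
      _ ≤ K ^ (n + 3) * (2 * 4 ^ n * (2 * N * K ^ (n + 2))) := by gcongr
      _ = _ := by rw [hL, mul_pow]; ring
  rw [Real.rpow_add hN0, Real.rpow_two, div_le_iff₀ (by positivity), div_le_iff₀ (by positivity)]
  have hX : 1 / 2 ≤ 4 * K ^ 5 * L ^ n * N * (N * δ) := hhalf.trans (by gcongr)
  have hd1 : 0 < d ^ ε := by positivity
  calc d ^ ε ≤ d ^ ε * (2 * (4 * K ^ 5 * L ^ n * N * (N * δ))) := by nlinarith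
    _ = (d ^ ε * L ^ n) * (8 * K ^ 5 * N ^ 2 * δ) := by ring
    _ ≤ (N : ℝ) ^ ε * (16 * K ^ 5 * N ^ 2 * δ) := by gcongr; norm_num
    _ = _ := by ring

/-- A real number that satisfies some power-type lower bound for all denominators cannot satisfy one
with exponent less than `2` for all large denominators. -/
theorem two_le_of_forall_div_rpow_le {τ μ c C N₀ ν : ℝ} (hc : 0 < c)
    (h : ∀ M N : ℤ, 0 < N → c / (N : ℝ) ^ ν ≤ |τ - M / N|) (hC : 0 < C)
    (hμ : ∀ M N : ℤ, N₀ ≤ N → C / (N : ℝ) ^ μ ≤ |τ - M / N|) : 2 ≤ μ := by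
  by_contra! hμ2
  obtain ⟨R, hR⟩ := Filter.eventually_atTop.mp
    ((tendsto_rpow_atTop (sub_pos.mpr hμ2)).eventually_gt_atTop C⁻¹)
  set S : ℕ := ⌈max R (max N₀ 1)⌉₊ with hS
  have hS' : max R (max N₀ 1) ≤ S := Nat.le_ceil _
  have hS0 : (1 : ℝ) ≤ S := ((le_max_right _ _).trans (le_max_right _ _)).trans hS'
  obtain ⟨n, hn⟩ := exists_nat_gt (max 1 ((S : ℝ) ^ |ν| / c))
  have hn1 : (1 : ℝ) < n := (le_max_left _ _).trans_lt hn
  have hn2 := (le_max_right _ _).trans_lt hn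
  rw [div_lt_iff₀ hc] at hn2
  obtain ⟨j, k, hk0, hkn, hjk⟩ :=
    Real.exists_int_int_abs_mul_sub_le τ (n := n) (by exact_mod_cast one_pos.trans hn1)
  have hk : (0 : ℝ) < k := by exact_mod_cast hk0
  have hk1 : (1 : ℝ) ≤ k := by exact_mod_cast hk0
  have habs : |τ - j / k| ≤ 1 / (n + 1) / k := by
    rw [le_div_iff₀ hk]
    refine le_of_eq_of_le ?_ hjk
    rw [← abs_of_pos hk, ← abs_mul, abs_of_pos hk]
    congr 1
    field_simp
  have hSk : (S : ℝ) < k := by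
    by_contra! hkS
    have h1 := (h j k hk0).trans habs
    have h2 : (k : ℝ) ^ ν ≤ (S : ℝ) ^ |ν| :=
      (Real.rpow_le_rpow_of_exponent_le hk1 (le_abs_self ν)).trans
        (Real.rpow_le_rpow hk.le hkS (abs_nonneg _))
    have hkν : 0 < (k : ℝ) ^ ν := by positivity
    rw [div_div, div_le_div_iff₀ hkν (by positivity)] at h1
    have : c * n ≤ c * ((n + 1) * k) := by
      gcongr
      nlinarith
    linarith
  have h1 := (hμ j k (by linarith [(le_max_left N₀ 1).trans (le_max_right R _)])).trans habs
  have h2 := hR k (by linarith [le_max_left R (max N₀ 1)])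
  have h3 : 1 / ((n : ℝ) + 1) / k ≤ 1 / k ^ 2 := by
    rw [div_div]
    have : (k : ℝ) ≤ n := by exact_mod_cast hkn
    gcongr
    nlinarith
  have h4 := h1.trans h3
  rw [div_le_div_iff₀ (by positivity) (by positivity)] at h4
  rw [Real.rpow_sub hk, Real.rpow_two, lt_div_iff₀ (by positivity), inv_mul_lt_iff₀ hC] at h2
  linarith

theorem muI_eq_two_of_linearForms {τ K : ℝ} {A B : ℕ → ℤ} (hK : 1 ≤ K)
    (hA : ∀ n, |(A n : ℝ)| ≤ K ^ (n + 1) * n.factorial)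
    (hAB : ∀ n, |A n * τ - B n| ≤ K ^ (n + 1) / n.factorial)
    (hdet : ∀ n, A n * B (n + 1) - A (n + 1) * B n ≠ 0) : muI τ = ((2 : ℝ) : EReal) := by
  apply le_antisymm
  · refine EReal.le_of_forall_lt_iff_le.mp fun μ hμ => sInf_le ⟨μ, ?_, rfl⟩
    have hμ' : 2 < μ := by exact_mod_cast hμ
    obtain ⟨c, hc, h⟩ := exists_div_rpow_le_abs_sub_div hK hA hAB hdet (sub_pos.mpr hμ')
    refine ⟨c, hc, 1, one_pos, fun M N hN => ?_⟩
    have := h M N (by exact_mod_cast one_pos.trans_le hN)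
    rwa [add_sub_cancel] at this
  · refine le_sInf ?_
    rintro _ ⟨μ, ⟨C, hC, N₀, -, hμ⟩, rfl⟩
    obtain ⟨c, hc, h⟩ := exists_div_rpow_le_abs_sub_div hK hA hAB hdet one_pos
    exact EReal.coe_le_coe_iff.mpr (two_le_of_forall_div_rpow_le hc h hC hμ)

/-- The integral `∫₀¹ (t (1 - t)) ^ n * exp (r t)`, a multiple of the remainder of the
`n`-th diagonal Padé approximant of the exponential function. -/
noncomputable def padeIntegral (r : ℝ) (n : ℕ) : ℝ :=
  ∫ t in (0 : ℝ)..1, (t * (1 - t)) ^ n * Real.exp (r * t)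

theorem intervalIntegrable_padeIntegral (r : ℝ) (n : ℕ) :
    IntervalIntegrable (fun t : ℝ => (t * (1 - t)) ^ n * Real.exp (r * t))
      MeasureTheory.volume 0 1 :=
  Continuous.intervalIntegrable (by fun_prop) _ _

theorem abs_padeIntegral_le (r : ℝ) (n : ℕ) : |padeIntegral r n| ≤ Real.exp |r| := by
  have := intervalIntegral.norm_integral_le_of_norm_le_const (a := 0) (b := 1) (C := Real.exp |r|)
    (f := fun t : ℝ => (t * (1 - t)) ^ n * Real.exp (r * t)) ?_
  · simpa [padeIntegral] using this
  intro t ht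
  rw [Set.uIoc_of_le zero_le_one] at ht
  have h1 : 0 ≤ t * (1 - t) := mul_nonneg ht.1.le (by linarith [ht.2])
  have h2 : t * (1 - t) ≤ 1 := by nlinarith [ht.1, ht.2]
  rw [Real.norm_eq_abs, abs_mul, Real.abs_exp, abs_of_nonneg (pow_nonneg h1 n)]
  refine (mul_le_of_le_one_left (Real.exp_pos _).le (pow_le_one₀ h1 h2)).trans
    (Real.exp_le_exp.mpr ?_)
  nlinarith [le_abs_self r, abs_nonneg r, ht.1, ht.2]

theorem mul_padeIntegral_zero (r : ℝ) : r * padeIntegral r 0 = Real.exp r - 1 := by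
  simp [padeIntegral]

theorem hasDerivAt_pade (r : ℝ) (n : ℕ) (t : ℝ) :
    HasDerivAt (fun t : ℝ => ((n + 1) * (t * (1 - t)) ^ n * (1 - 2 * t) - r * (t * (1 - t)) ^ (n + 1))
        * Real.exp (r * t))
      (((n + 1) * (n * (t * (1 - t)) ^ (n - 1) * (1 - 2 * t)) * (1 - 2 * t)
        - 2 * (n + 1) * (t * (1 - t)) ^ n - r ^ 2 * (t * (1 - t)) ^ (n + 1)) * Real.exp (r * t)) t := by
  have hw : HasDerivAt (fun t : ℝ => t * (1 - t)) (1 - 2 * t) t :=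
    ((hasDerivAt_id t).mul ((hasDerivAt_id t).const_sub 1)).congr_deriv (by simp; ring)
  have hl : HasDerivAt (fun t : ℝ => 1 - 2 * t) (-2) t :=
    (((hasDerivAt_id t).const_mul 2).const_sub 1).congr_deriv (by simp)
  have he : HasDerivAt (fun t => Real.exp (r * t)) (Real.exp (r * t) * r) t :=
    (((hasDerivAt_id t).const_mul r).exp).congr_deriv (by simp)
  refine ((((hw.pow n).const_mul ((n : ℝ) + 1)).mul hl).sub ((hw.pow (n + 1)).const_mul r)
    |>.mul he).congr_deriv ?_
  simp only [Pi.pow_apply, Pi.mul_apply, Pi.sub_apply, Nat.add_sub_cancel]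
  push_cast
  ring

theorem sq_mul_padeIntegral_one (r : ℝ) :
    r ^ 2 * padeIntegral r 1 = Real.exp r + 1 - 2 * padeIntegral r 0 := by
  have h := intervalIntegral.integral_eq_sub_of_hasDerivAt (a := 0) (b := 1)
    (fun t _ => hasDerivAt_pade r 0 t) (Continuous.intervalIntegrable (by fun_prop) _ _)
  have h2 : (∫ t in (0 : ℝ)..1, ((-2) * ((t * (1 - t)) ^ 0 * Real.exp (r * t))
      - r ^ 2 * ((t * (1 - t)) ^ 1 * Real.exp (r * t)))) =
      -2 * padeIntegral r 0 - r ^ 2 * padeIntegral r 1 := by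
    rw [intervalIntegral.integral_sub ((intervalIntegrable_padeIntegral r 0).const_mul _)
      ((intervalIntegrable_padeIntegral r 1).const_mul _), intervalIntegral.integral_const_mul,
      intervalIntegral.integral_const_mul]
    rfl
  have h3 : -2 * padeIntegral r 0 - r ^ 2 * padeIntegral r 1 = -Real.exp r - 1 := by
    rw [← h2]
    convert h using 1
    · congr 1
      ext t
      push_cast
      ring
    · simp; ring
  linarith

theorem sq_mul_padeIntegral_add_two (r : ℝ) (n : ℕ) :
    r ^ 2 * padeIntegral r (n + 2) =
      (n + 2) * (n + 1) * padeIntegral r n - (n + 2) * (4 * n + 6) * padeIntegral r (n + 1) := by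
  have h := intervalIntegral.integral_eq_sub_of_hasDerivAt (a := 0) (b := 1)
    (fun t _ => hasDerivAt_pade r (n + 1) t) (Continuous.intervalIntegrable (by fun_prop) _ _)
  have h2 : (∫ t in (0 : ℝ)..1,
      ((n + 2) * (n + 1) * ((t * (1 - t)) ^ n * Real.exp (r * t))
      - (n + 2) * (4 * n + 6) * ((t * (1 - t)) ^ (n + 1) * Real.exp (r * t))
      - r ^ 2 * ((t * (1 - t)) ^ (n + 2) * Real.exp (r * t)))) =
      (n + 2) * (n + 1) * padeIntegral r n - (n + 2) * (4 * n + 6) * padeIntegral r (n + 1)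
      - r ^ 2 * padeIntegral r (n + 2) := by
    have hi := fun (m : ℕ) (a : ℝ) => (intervalIntegrable_padeIntegral r m).const_mul a
    rw [intervalIntegral.integral_sub ((hi n _).sub (hi (n + 1) _)) (hi (n + 2) _),
      intervalIntegral.integral_sub (hi n _) (hi (n + 1) _), intervalIntegral.integral_const_mul,
      intervalIntegral.integral_const_mul, intervalIntegral.integral_const_mul]
    rfl
  have h3 : (∫ t in (0 : ℝ)..1,
      ((n + 2) * (n + 1) * ((t * (1 - t)) ^ n * Real.exp (r * t))
      - (n + 2) * (4 * n + 6) * ((t * (1 - t)) ^ (n + 1) * Real.exp (r * t))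
      - r ^ 2 * ((t * (1 - t)) ^ (n + 2) * Real.exp (r * t)))) = 0 := by
    convert h using 1
    · congr 1
      ext t
      push_cast [Nat.add_sub_cancel]
      ring
    · simp
  linarith

/-- The solution with initial values `u`, `v` of the three-term recurrence satisfied by the
numerators and denominators of the diagonal Padé approximants of `exp` at `x / y`. -/
def padeSeq (x y u v : ℤ) : ℕ → ℤ
  | 0 => u
  | 1 => v
  | n + 2 => x ^ 2 * padeSeq x y u v n - (4 * n + 6) * y * padeSeq x y u v (n + 1)

theorem abs_padeSeq_le {x y u v : ℤ} {K : ℝ} (hK : 1 ≤ K) (hu : |(u : ℝ)| ≤ K) (hv : |(v : ℝ)| ≤ K)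
    (hxy : (x : ℝ) ^ 2 + 4 * |(y : ℝ)| ≤ K) (n : ℕ) :
    |(padeSeq x y u v n : ℝ)| ≤ K ^ (n + 1) * n.factorial := by
  induction n using Nat.twoStepInduction with
  | zero => simpa [padeSeq] using hu
  | one => simpa [padeSeq] using hv.trans (le_self_pow₀ hK two_ne_zero)
  | more n h0 h1 =>
    rw [padeSeq]
    push_cast
    have hn : (0 : ℝ) ≤ n := Nat.cast_nonneg n
    have hf : (n.factorial : ℝ) ≤ (n + 2).factorial := by
      exact_mod_cast Nat.factorial_le (by omega)
    have hf1 : (4 * n + 6 : ℝ) * (n + 1).factorial ≤ 4 * (n + 2).factorial := by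
      rw [Nat.factorial_succ (n + 1)]
      push_cast
      nlinarith [(Nat.cast_nonneg (n + 1).factorial : (0 : ℝ) ≤ _)]
    calc |(x : ℝ) ^ 2 * padeSeq x y u v n - (4 * n + 6) * y * padeSeq x y u v (n + 1)|
        ≤ x ^ 2 * |(padeSeq x y u v n : ℝ)|
          + (4 * n + 6) * |(y : ℝ)| * |(padeSeq x y u v (n + 1) : ℝ)| := by
          refine (abs_sub _ _).trans_eq ?_
          rw [abs_mul, abs_mul, abs_mul, abs_of_nonneg (sq_nonneg (x : ℝ)),
            abs_of_nonneg (by positivity : (0 : ℝ) ≤ 4 * n + 6)]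
      _ ≤ x ^ 2 * (K ^ (n + 1) * n.factorial)
          + (4 * n + 6) * |(y : ℝ)| * (K ^ (n + 2) * (n + 1).factorial) := by gcongr
      _ = x ^ 2 * (K ^ (n + 1) * n.factorial)
          + |(y : ℝ)| * K ^ (n + 2) * ((4 * n + 6) * (n + 1).factorial) := by ring
      _ ≤ x ^ 2 * (K ^ (n + 2) * (n + 2).factorial)
          + |(y : ℝ)| * K ^ (n + 2) * (4 * (n + 2).factorial) := by gcongr; simp
      _ = (x ^ 2 + 4 * |(y : ℝ)|) * (K ^ (n + 2) * (n + 2).factorial) := by ring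
      _ ≤ K * (K ^ (n + 2) * (n + 2).factorial) := by gcongr
      _ = _ := by ring

theorem padeSeq_casoratian (x y u v u' v' : ℤ) (n : ℕ) :
    padeSeq x y u v n * padeSeq x y u' v' (n + 1) - padeSeq x y u v (n + 1) * padeSeq x y u' v' n
      = (-x ^ 2) ^ n * (u * v' - v * u') := by
  induction n with
  | zero => simp [padeSeq]
  | succ n ih =>
    rw [pow_succ, mul_right_comm, ← ih, padeSeq, padeSeq]
    ring

theorem padeSeq_mul_exp_sub_padeSeq {x y : ℤ} (hx : x ≠ 0) (hy : y ≠ 0) (n : ℕ) :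
    padeSeq x y 1 (x - 2 * y) n * Real.exp (x / y) - padeSeq x y 1 (-x - 2 * y) n
      = x ^ (2 * n + 1) / (y ^ (n + 1) * n.factorial) * padeIntegral (x / y) n := by
  have hx' : (x : ℝ) ≠ 0 := by exact_mod_cast hx
  have hy' : (y : ℝ) ≠ 0 := by exact_mod_cast hy
  have h0 := mul_padeIntegral_zero (x / y)
  induction n using Nat.twoStepInduction with
  | zero => simp [padeSeq, ← h0]
  | one =>
    have h1 := sq_mul_padeIntegral_one (x / y)
    have h2 : (x : ℝ) ^ (2 * 1 + 1) / (y ^ (1 + 1) * (1 : ℕ).factorial) * padeIntegral (x / y) 1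
        = x * ((x / y : ℝ) ^ 2 * padeIntegral (x / y) 1) := by
      simp; field_simp
    have h3 : (x : ℝ) * padeIntegral (x / y) 0 = y * (Real.exp (x / y) - 1) := by
      rw [← h0]; field_simp
    rw [h2, h1]
    simp only [padeSeq]
    push_cast
    linear_combination 2 * h3
  | more n ih0 ih1 =>
    have h2 := sq_mul_padeIntegral_add_two (x / y) n
    have h3 : (x : ℝ) ^ (2 * (n + 2) + 1) / (y ^ (n + 2 + 1) * (n + 2).factorial)
        * padeIntegral (x / y) (n + 2) = x ^ (2 * n + 3) / (y ^ (n + 1) * (n + 2).factorial) *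
          ((x / y : ℝ) ^ 2 * padeIntegral (x / y) (n + 2)) := by
      field_simp
      ring
    rw [h3, h2, padeSeq, padeSeq]
    push_cast
    have h4 : (x : ℝ) ^ (2 * n + 3) / (y ^ (n + 1) * (n + 2).factorial) *
        ((n + 2) * (n + 1) * padeIntegral (x / y) n
          - (n + 2) * (4 * n + 6) * padeIntegral (x / y) (n + 1))
        = x ^ 2 * (x ^ (2 * n + 1) / (y ^ (n + 1) * n.factorial) * padeIntegral (x / y) n)
          - (4 * n + 6) * y * (x ^ (2 * (n + 1) + 1) / (y ^ (n + 1 + 1) * (n + 1).factorial)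
            * padeIntegral (x / y) (n + 1)) := by
      rw [Nat.factorial_succ (n + 1), Nat.factorial_succ n]
      push_cast
      have hf : (n.factorial : ℝ) ≠ 0 := by positivity
      have hn1 : (n + 1 : ℝ) ≠ 0 := by positivity
      have hn2 : (n + 1 + 1 : ℝ) ≠ 0 := by positivity
      field_simp
      ring
    rw [h4, ← ih0, ← ih1]
    ring

/-- `μ_I(e^{x/y}) = 2` for every nonzero integer `x` and positive
integer `y`. -/
theorem muI_exp_rat_eq_two (x : ℤ) (hx : x ≠ 0) (y : ℤ) (hy : 0 < y) :
    muI (Real.exp ((x : ℝ) / (y : ℝ))) = ((2 : ℝ) : EReal) := by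
  set E : ℝ := Real.exp |(x / y : ℝ)| with hE
  have hE1 : 1 ≤ E := Real.one_le_exp (abs_nonneg _)
  have hx1 : (1 : ℝ) ≤ |(x : ℝ)| := by exact_mod_cast Int.one_le_abs hx
  have hx2 : |(x : ℝ)| ≤ x ^ 2 := by rw [← sq_abs]; nlinarith
  have hy1 : (1 : ℝ) ≤ y := by exact_mod_cast hy
  have hxE : (x : ℝ) ^ 2 ≤ x ^ 2 * E := le_mul_of_one_le_right (sq_nonneg _) hE1
  have hyabs : |(y : ℝ)| = y := abs_of_pos (by linarith)
  refine muI_eq_two_of_linearForms (K := x ^ 2 * E + 4 * y) (A := padeSeq x y 1 (x - 2 * y))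
    (B := padeSeq x y 1 (-x - 2 * y)) (by linarith) (fun n => ?_) (fun n => ?_) (fun n => ?_)
  · refine abs_padeSeq_le (by linarith) (by simp; linarith) ?_ (by linarith) n
    push_cast
    rw [abs_le]
    constructor <;> linarith [neg_abs_le (x : ℝ), le_abs_self (x : ℝ)]
  · rw [padeSeq_mul_exp_sub_padeSeq hx hy.ne', abs_mul, abs_div, abs_mul, abs_pow, abs_pow, hyabs,
      Nat.abs_cast, div_mul_eq_mul_div]
    have hpow : |(x : ℝ)| ^ (2 * n + 1) ≤ (x ^ 2) ^ (n + 1) := by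
      rw [← sq_abs, ← pow_mul]
      exact pow_le_pow_right₀ hx1 (by omega)
    have hint : |padeIntegral (x / y) n| ≤ E ^ (n + 1) :=
      (abs_padeIntegral_le _ n).trans (le_self_pow₀ hE1 n.succ_ne_zero)
    have hyn : (1 : ℝ) ≤ y ^ (n + 1) := one_le_pow₀ hy1
    calc |(x : ℝ)| ^ (2 * n + 1) * |padeIntegral (x / y) n| / (y ^ (n + 1) * n.factorial)
        ≤ (x ^ 2) ^ (n + 1) * E ^ (n + 1) / (1 * n.factorial) := by gcongr
      _ = (x ^ 2 * E) ^ (n + 1) / n.factorial := by rw [one_mul, mul_pow]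
      _ ≤ _ := by gcongr; linarith
  · rw [padeSeq_casoratian]
    refine mul_ne_zero (pow_ne_zero _ (neg_ne_zero.mpr (pow_ne_zero _ hx))) ?_
    ring_nf
    simpa using hx
end

section
/- Let m and s be positive integers and let (c_n)_{n≥1} and (d_n)_{n≥1} be sequences of positive rational numbers that are periodic with period s (i.e., c_{n+s} = c_n and d_{n+s} = d_n for all n ≥ 1). Then the continued fraction τ = K_{n=1}^∞ 1/(c_n + d_n·⌈n/s⌉^m), with partial numerators all equal to 1 and partial denominators b_n = c_n + d_n·⌈n/s⌉^m, converges to an irrational number τ with μ_I(τ) = 2. -/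
open Filter

/-- Numerators of the convergents of the generalized continued fraction
`K_{n=1}^∞ a n / b n` with rational partial coefficients. -/
def cfAQ (a b : ℕ → ℚ) : ℕ → ℚ
  | 0 => 0
  | 1 => a 1
  | (n + 2) => b (n + 2) * cfAQ a b (n + 1) + a (n + 2) * cfAQ a b n

/-- Denominators of the convergents of the generalized continued fraction
`K_{n=1}^∞ a n / b n` with rational partial coefficients. -/
def cfBQ (a b : ℕ → ℚ) : ℕ → ℚ
  | 0 => 1
  | 1 => b 1
  | (n + 2) => b (n + 2) * cfBQ a b (n + 1) + a (n + 2) * cfBQ a b n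

theorem two_le_of_irrationality_bound {τ μ c N₀ : ℝ} (hc : 0 < c) (hN₀ : 0 < N₀)
    (h : ∀ M N : ℤ, (N : ℝ) ≥ N₀ → |τ - (M : ℝ) / (N : ℝ)| ≥ c / (N : ℝ) ^ μ) : 2 ≤ μ := by
  by_contra! hμ
  obtain ⟨T, hT⟩ := exists_nat_ge N₀
  have hT0 : (0 : ℝ) < T := hN₀.trans_le hT
  set e : ℝ := max (μ - 1) 0 with he
  have he1 : e < 1 := max_lt (by linarith) one_pos
  have key : ∀ n : ℕ, 1 ≤ n → (n : ℝ) ^ (1 - e) ≤ (T : ℝ) ^ μ / c := by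
    intro n hn
    obtain ⟨q, hq, hqn⟩ := Real.exists_rat_abs_sub_le_and_den_le τ hn
    have hden : (1 : ℝ) ≤ q.den := by exact_mod_cast q.pos
    have hden0 : (0 : ℝ) < q.den := by linarith
    have hn1 : (1 : ℝ) ≤ n := by exact_mod_cast hn
    have hn0 : (0 : ℝ) < n := by linarith
    have h1 := h (q.num * T) (q.den * T) (by push_cast; nlinarith)
    have hqe : (((q.num * T : ℤ) : ℝ) / ((q.den * T : ℤ) : ℝ)) = (q : ℝ) := by
      push_cast
      rw [mul_div_mul_right _ _ hT0.ne']
      exact_mod_cast (Rat.num_div_den q)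
    rw [hqe] at h1
    have h2 : c / ((q.den : ℝ) * T) ^ μ ≤ 1 / ((n + 1) * q.den) := by
      have := h1.le.trans hq
      push_cast at this
      exact this
    rw [Real.mul_rpow hden0.le hT0.le, div_le_div_iff₀ (by positivity) (by positivity)] at h2
    have h3 : (q.den : ℝ) ^ μ = (q.den : ℝ) ^ (μ - 1) * q.den := by
      rw [Real.rpow_sub_one hden0.ne']; field_simp
    have h4 : (q.den : ℝ) ^ (μ - 1) ≤ (n : ℝ) ^ e :=
      (Real.rpow_le_rpow_of_exponent_le hden (le_max_left _ _)).trans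
        (Real.rpow_le_rpow hden0.le (by exact_mod_cast hqn) (le_max_right _ _))
    have h5 : c * (n + 1) ≤ (q.den : ℝ) ^ (μ - 1) * (T : ℝ) ^ μ := by
      rw [h3] at h2
      refine le_of_mul_le_mul_right ?_ hden0
      linarith
    have h6 : c * n ≤ (n : ℝ) ^ e * (T : ℝ) ^ μ := by
      have : (q.den : ℝ) ^ (μ - 1) * (T : ℝ) ^ μ ≤ (n : ℝ) ^ e * (T : ℝ) ^ μ := by gcongr
      linarith
    rw [Real.rpow_sub hn0, Real.rpow_one, div_le_div_iff₀ (by positivity) hc]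
    linarith
  have ht : Tendsto (fun n : ℕ => (n : ℝ) ^ (1 - e)) atTop atTop :=
    (tendsto_rpow_atTop (by linarith)).comp tendsto_natCast_atTop_atTop
  obtain ⟨n, hn, hn'⟩ := ((ht.eventually_gt_atTop ((T : ℝ) ^ μ / c)).and
    (eventually_ge_atTop 1)).exists
  exact absurd (key n hn') (not_le.mpr hn)

theorem irrational_of_irrationality_bound {τ μ c N₀ : ℝ} (hc : 0 < c) (hN₀ : 0 < N₀)
    (h : ∀ M N : ℤ, (N : ℝ) ≥ N₀ → |τ - (M : ℝ) / (N : ℝ)| ≥ c / (N : ℝ) ^ μ) :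
    Irrational τ := by
  rintro ⟨q, rfl⟩
  obtain ⟨T, hT⟩ := exists_nat_ge N₀
  have hT0 : (0 : ℝ) < T := hN₀.trans_le hT
  have hden : (1 : ℝ) ≤ q.den := by exact_mod_cast q.pos
  have h1 := h (q.num * T) (q.den * T) (by push_cast; nlinarith)
  have hqe : (((q.num * T : ℤ) : ℝ) / ((q.den * T : ℤ) : ℝ)) = (q : ℝ) := by
    push_cast
    rw [mul_div_mul_right _ _ hT0.ne']
    exact_mod_cast (Rat.num_div_den q)
  rw [hqe, sub_self, abs_zero] at h1
  have : 0 < c / ((q.den * T : ℤ) : ℝ) ^ μ := by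
    push_cast
    have : (0 : ℝ) < q.den * T := by nlinarith
    positivity
  linarith

theorem muI_eq_two_of_forall_bound {τ : ℝ}
    (h : ∀ ε > (0 : ℝ), ∃ c > (0 : ℝ), ∃ N₀ > (0 : ℝ), ∀ M N : ℤ,
      (N : ℝ) ≥ N₀ → |τ - (M : ℝ) / (N : ℝ)| ≥ c / (N : ℝ) ^ (2 + ε)) :
    muI τ = ((2 : ℝ) : EReal) := by
  apply le_antisymm
  · refine EReal.le_of_forall_lt_iff_le.mp fun z hz => ?_
    have hz' : (2 : ℝ) < z := by exact_mod_cast hz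
    refine sInf_le ⟨z, ?_, rfl⟩
    simpa using h (z - 2) (by linarith)
  · refine le_sInf ?_
    rintro _ ⟨μ, ⟨c, hc, N₀, hN₀, hμ⟩, rfl⟩
    exact EReal.coe_le_coe_iff.mpr (two_le_of_irrationality_bound hc hN₀ hμ)

theorem exists_int_eq_pow_mul_of_recurrence {X b : ℕ → ℝ} {D : ℕ}
    (hb : ∀ n, 1 ≤ n → ∃ z : ℤ, (D : ℝ) * b n = z)
    (hX0 : ∃ z : ℤ, X 0 = z) (hX1 : ∃ z : ℤ, (D : ℝ) * X 1 = z)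
    (hX : ∀ n, X (n + 2) = b (n + 2) * X (n + 1) + X n) (n : ℕ) :
    ∃ z : ℤ, (D : ℝ) ^ n * X n = z := by
  induction n using Nat.twoStepInduction with
  | zero => simpa using hX0
  | one => simpa using hX1
  | more n ih0 ih1 =>
    obtain ⟨x, hx⟩ := ih0
    obtain ⟨y, hy⟩ := ih1
    obtain ⟨z, hz⟩ := hb (n + 2) (by omega)
    refine ⟨z * y + D ^ 2 * x, ?_⟩
    push_cast
    rw [← hx, ← hy, ← hz, hX]
    ring

theorem convergents_det {A B b : ℕ → ℝ} (hA0 : A 0 = 0) (hB0 : B 0 = 1) (hA1 : A 1 = 1)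
    (hA : ∀ n, A (n + 2) = b (n + 2) * A (n + 1) + A n)
    (hB : ∀ n, B (n + 2) = b (n + 2) * B (n + 1) + B n) (n : ℕ) :
    A (n + 1) * B n - A n * B (n + 1) = (-1) ^ n := by
  induction n with
  | zero => simp [hA0, hB0, hA1]
  | succ n ih => rw [hA, hB, pow_succ, ← ih]; ring

theorem denominators_pos {B b : ℕ → ℝ} (hB0 : B 0 = 1) (hB1 : B 1 = b 1)
    (hB : ∀ n, B (n + 2) = b (n + 2) * B (n + 1) + B n)
    (hb : ∀ n, 1 ≤ n → 0 < b n) (n : ℕ) : 0 < B n := by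
  induction n using Nat.twoStepInduction with
  | zero => simp [hB0]
  | one => rw [hB1]; exact hb 1 le_rfl
  | more n ih0 ih1 =>
    rw [hB]
    have := hb (n + 2) (by omega)
    positivity

theorem eventually_mul_le_succ {B b : ℕ → ℝ} (hpos : ∀ n, 0 < B n)
    (hB : ∀ n, B (n + 2) = b (n + 2) * B (n + 1) + B n) (hb : Tendsto b atTop atTop) (K : ℝ) :
    ∀ᶠ n in atTop, K * B n ≤ B (n + 1) := by
  obtain ⟨n₁, h⟩ := eventually_atTop.mp (hb.eventually_ge_atTop K)
  filter_upwards [eventually_ge_atTop (n₁ + 1)] with n hn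
  obtain ⟨k, rfl⟩ : ∃ k, n = k + 1 := ⟨n - 1, by omega⟩
  rw [hB]
  have h1 := h (k + 2) (by omega)
  nlinarith [hpos k, hpos (k + 1), mul_le_mul_of_nonneg_right h1 (hpos (k + 1)).le]

theorem pow_mul_le_of_mul_le_succ {B : ℕ → ℝ} {K : ℝ} (hK : 0 ≤ K) {n₁ : ℕ}
    (h : ∀ n ≥ n₁, K * B n ≤ B (n + 1)) {n : ℕ} (hn : n₁ ≤ n) (k : ℕ) :
    K ^ k * B n ≤ B (n + k) := by
  induction k with
  | zero => simp
  | succ k ih =>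
    calc K ^ (k + 1) * B n = K * (K ^ k * B n) := by ring
      _ ≤ K * B (n + k) := by gcongr
      _ ≤ B (n + (k + 1)) := h _ (by omega)

theorem exists_eventually_pow_le {B b : ℕ → ℝ} (hpos : ∀ n, 0 < B n)
    (hB : ∀ n, B (n + 2) = b (n + 2) * B (n + 1) + B n) (hb : Tendsto b atTop atTop)
    {K : ℝ} (hK : 0 < K) : ∃ c > 0, ∀ᶠ n in atTop, c * K ^ n ≤ B n := by
  obtain ⟨n₁, h⟩ := eventually_atTop.mp (eventually_mul_le_succ hpos hB hb K)
  refine ⟨B n₁ / K ^ n₁, div_pos (hpos _) (by positivity), ?_⟩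
  filter_upwards [eventually_ge_atTop n₁] with n hn
  obtain ⟨k, rfl⟩ := Nat.exists_eq_add_of_le hn
  refine le_trans (le_of_eq ?_) (pow_mul_le_of_mul_le_succ hK.le h le_rfl k)
  rw [pow_add]; field_simp

theorem exists_limit_convergents {A B b : ℕ → ℝ} (hpos : ∀ n, 0 < B n)
    (hdet : ∀ n, A (n + 1) * B n - A n * B (n + 1) = (-1) ^ n)
    (hB : ∀ n, B (n + 2) = b (n + 2) * B (n + 1) + B n) (hb : Tendsto b atTop atTop) :
    ∃ τ, Tendsto (fun n => A n / B n) atTop (nhds τ) ∧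
      ∀ᶠ n in atTop, |B n * τ - A n| ≤ 2 / B (n + 1) := by
  obtain ⟨n₁, h⟩ := eventually_atTop.mp (eventually_mul_le_succ hpos hB hb 2)
  have hstep : ∀ n ≥ n₁, ∀ k, dist (A (n + k) / B (n + k)) (A (n + (k + 1)) / B (n + (k + 1))) ≤
      (2 / (B n * B (n + 1))) / 2 / 2 ^ k := by
    intro n hn k
    have hp1 := hpos (n + k)
    have hp2 := hpos (n + k + 1)
    have hp3 := hpos n
    have hp4 := hpos (n + 1)
    have h1 : |A (n + k) / B (n + k) - A (n + k + 1) / B (n + k + 1)| =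
        1 / (B (n + k) * B (n + k + 1)) := by
      have : A (n + k) / B (n + k) - A (n + k + 1) / B (n + k + 1) =
          -((-1) ^ (n + k)) / (B (n + k) * B (n + k + 1)) := by
        rw [← hdet]; field_simp; ring
      rw [this, abs_div, abs_neg, abs_pow, abs_neg, abs_one, one_pow, abs_of_pos (by positivity)]
    rw [Real.dist_eq, ← add_assoc, h1]
    have h2 := pow_mul_le_of_mul_le_succ zero_le_two h hn k
    have h3 := pow_mul_le_of_mul_le_succ zero_le_two h (n := n + 1) (by omega) k
    rw [add_right_comm] at h3
    have h4 : B (n + 1) ≤ B (n + k + 1) := by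
      refine le_trans ?_ h3
      have : (1 : ℝ) ≤ 2 ^ k := one_le_pow₀ one_le_two
      nlinarith
    rw [div_div, div_div, div_le_div_iff₀ (by positivity) (by positivity)]
    have := mul_le_mul h2 h4 hp4.le hp1.le
    nlinarith
  obtain ⟨τ, hτ⟩ := cauchySeq_tendsto_of_complete (cauchySeq_of_le_geometric_two (hstep n₁ le_rfl))
  have hτ' : Tendsto (fun n => A n / B n) atTop (nhds τ) := by
    rw [← tendsto_add_atTop_iff_nat n₁]
    simpa only [add_comm n₁] using hτ
  refine ⟨τ, hτ', ?_⟩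
  filter_upwards [eventually_ge_atTop n₁] with n hn
  have ht : Tendsto (fun k => A (n + k) / B (n + k)) atTop (nhds τ) := by
    have := (tendsto_add_atTop_iff_nat n).mpr hτ'
    simpa only [add_comm n] using this
  have hd := dist_le_of_le_geometric_two_of_tendsto₀ (hstep n hn) ht
  have hp3 := hpos n
  have hp4 := hpos (n + 1)
  rw [add_zero, Real.dist_eq, abs_sub_comm] at hd
  have : B n * τ - A n = B n * (τ - A n / B n) := by field_simp
  rw [this, abs_mul, abs_of_pos hp3]
  calc B n * |τ - A n / B n| ≤ B n * (2 / (B n * B (n + 1))) := by gcongr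
    _ = 2 / B (n + 1) := by field_simp

theorem int_approx_lower_bound {τ x Q : ℝ} {p q M N : ℤ} (hN : 0 < N)
    (hne : p * N - q * M ≠ 0) (hx : |q * τ - p| ≤ x) (hxN : x * (2 * N) ≤ 1)
    (hq0 : 0 < (q : ℝ)) (hqQ : (q : ℝ) ≤ Q) :
    1 / (2 * N * Q) ≤ |τ - (M : ℝ) / (N : ℝ)| := by
  have hN' : (0 : ℝ) < N := by exact_mod_cast hN
  have h1 : (1 : ℝ) ≤ |(p : ℝ) * N - q * M| := by exact_mod_cast Int.one_le_abs hne
  have h2 : (p : ℝ) * N - q * M = q * N * (τ - M / N) - N * (q * τ - p) := by field_simp; ring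
  have h3 : |(p : ℝ) * N - q * M| ≤ q * N * |τ - M / N| + N * |q * τ - p| := by
    rw [h2]
    refine (abs_sub _ _).trans (le_of_eq ?_)
    rw [abs_mul, abs_mul (N : ℝ), abs_of_pos hN', abs_of_pos (mul_pos hq0 hN')]
  have h4 : q * N * |τ - M / N| ≤ Q * N * |τ - M / N| := by gcongr
  have h5 : (N : ℝ) * |q * τ - p| ≤ N * x := by gcongr
  have hQ : 0 < Q := hq0.trans_le hqQ
  rw [div_le_iff₀ (by positivity)]
  linarith

theorem exists_irrationality_bound {A B b : ℕ → ℝ} {D : ℕ} {E τ : ℝ} (hD : 1 ≤ D) (hE : 1 ≤ E)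
    (hpos : ∀ n, 0 < B n)
    (hdet : ∀ n, A (n + 1) * B n - A n * B (n + 1) = (-1) ^ n)
    (hB : ∀ n, B (n + 2) = b (n + 2) * B (n + 1) + B n) (hb : Tendsto b atTop atTop)
    (hbE : ∀ n, 1 ≤ n → b n ≤ E ^ n)
    (hAz : ∀ n, ∃ z : ℤ, (D : ℝ) ^ n * A n = z) (hBz : ∀ n, ∃ z : ℤ, (D : ℝ) ^ n * B n = z)
    (hτ : ∀ᶠ n in atTop, |B n * τ - A n| ≤ 2 / B (n + 1)) {ε : ℝ} (hε : 0 < ε) :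
    ∃ c > (0 : ℝ), ∃ N₀ > (0 : ℝ), ∀ M N : ℤ,
      (N : ℝ) ≥ N₀ → |τ - (M : ℝ) / (N : ℝ)| ≥ c / (N : ℝ) ^ (2 + ε) := by
  have hD1 : (1 : ℝ) ≤ D := by exact_mod_cast hD
  have hD0 : (0 : ℝ) < D := by linarith
  have hE0 : (0 : ℝ) < E := by linarith
  obtain ⟨G, hG⟩ : ∃ G : ℝ, G = D ^ 2 * E := ⟨_, rfl⟩
  have hG0 : 0 < G := by rw [hG]; positivity
  obtain ⟨c₀, hc₀, hgrow⟩ := exists_eventually_pow_le hpos hB hb (K := D * G ^ (1 / ε)) (by positivity)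
  obtain ⟨n₁, hn₁⟩ := eventually_atTop.mp (hτ.and (hgrow.and
    ((eventually_mul_le_succ hpos hB hb D).and (eventually_mul_le_succ hpos hB hb (2 * D)))))
  set r : ℕ → ℝ := fun n => 2 * D ^ n / B (n + 1) with hr
  have hrpos : ∀ n, 0 < r n := fun n => by have := hpos (n + 1); simp only [hr]; positivity
  have hr2 : ∀ n ≥ n₁, r (n + 1) ≤ (1 / 2) * r n := by
    intro n hn
    have h1 := (hn₁ (n + 1) (by omega)).2.2.2
    have := hpos (n + 1)
    have := hpos (n + 1 + 1)
    simp only [hr]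
    rw [← mul_div_assoc, div_le_div_iff₀ (by positivity) (by positivity), pow_succ]
    calc 2 * ((D : ℝ) ^ n * D) * B (n + 1) = D ^ n * (2 * D * B (n + 1)) := by ring
      _ ≤ D ^ n * B (n + 1 + 1) := by gcongr
      _ = _ := by ring
  have hrgeo : ∀ k, r (n₁ + k) ≤ (1 / 2) ^ k * r n₁ := by
    intro k
    induction k with
    | zero => simp
    | succ k ih =>
      calc r (n₁ + (k + 1)) ≤ (1 / 2) * r (n₁ + k) := hr2 (n₁ + k) (Nat.le_add_right _ _)
        _ ≤ (1 / 2) * ((1 / 2) ^ k * r n₁) := by gcongr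
        _ = _ := by ring
  have hrsmall : ∀ x > (0 : ℝ), ∃ k, r (n₁ + k) < x := by
    intro x hx
    obtain ⟨k, hk⟩ := exists_pow_lt_of_lt_one (div_pos hx (hrpos n₁)) (by norm_num : (1 / 2 : ℝ) < 1)
    exact ⟨k, (hrgeo k).trans_lt ((lt_div_iff₀ (hrpos n₁)).mp hk)⟩
  set C : ℝ := 8 * D * E * (4 / c₀) ^ ε with hC
  have hC0 : 0 < C := by positivity
  refine ⟨1 / (2 * C), by positivity, max 1 (1 / r n₁), by positivity, fun M N hN => ?_⟩
  have hN1 : (1 : ℝ) ≤ N := (le_max_left _ _).trans hN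
  have hN0 : (0 : ℝ) < N := by linarith
  have hNz : 0 < N := by exact_mod_cast hN0
  have hNr : 1 ≤ r n₁ * N := by
    have := (le_max_right _ _).trans hN
    rwa [div_le_iff₀ (hrpos n₁), mul_comm] at this
  classical
  have hex := hrsmall (1 / (2 * N)) (by positivity)
  obtain ⟨k, hk, hmin⟩ : ∃ k, r (n₁ + (k + 1)) * (2 * N) ≤ 1 ∧ 1 ≤ r (n₁ + k) * (2 * N) := by
    have h0 : Nat.find hex ≠ 0 := by
      intro h0
      have := Nat.find_spec hex
      rw [h0, add_zero, lt_div_iff₀ (by positivity)] at this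
      linarith
    obtain ⟨k, hk⟩ := Nat.exists_eq_succ_of_ne_zero h0
    have h1 := Nat.find_spec hex
    have h2 := Nat.find_min hex (m := k) (by omega)
    rw [hk, lt_div_iff₀ (by positivity)] at h1
    rw [not_lt, div_le_iff₀ (by positivity)] at h2
    exact ⟨k, h1.le, h2⟩
  rw [← add_assoc] at hk
  obtain ⟨n, hn⟩ : ∃ n, n = n₁ + k := ⟨_, rfl⟩
  rw [← hn] at hk hmin
  have hnn : n₁ ≤ n := by omega
  have p0 := hpos n
  have p1 := hpos (n + 1)
  have p2 := hpos (n + 2)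
  have hk2 : r (n + 2) * (2 * N) ≤ 1 := by
    refine le_trans ?_ hk
    have := hr2 (n + 1) (by omega)
    have h' := hrpos (n + 1)
    have : r (n + 2) ≤ r (n + 1) := by
      rw [show n + 2 = n + 1 + 1 from rfl]; linarith
    gcongr
  have hBN : B (n + 1) ≤ 4 * N * D ^ n := by
    simp only [hr] at hmin
    rw [div_mul_eq_mul_div, le_div_iff₀ p1] at hmin
    linarith
  have hBN' : B (n + 1) ≤ 4 * N * D ^ (n + 1) := by
    refine hBN.trans ?_
    gcongr
    omega
  have hGN : G ^ (n + 1) ≤ (4 / c₀) ^ ε * (N : ℝ) ^ ε := by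
    have h1 := (hn₁ (n + 1) (by omega)).2.1
    have h2 : (G ^ (1 / ε)) ^ (n + 1) ≤ 4 / c₀ * N := by
      have h3 := h1.trans hBN'
      rw [mul_pow] at h3
      have hDp : (0 : ℝ) < D ^ (n + 1) := by positivity
      rw [div_mul_eq_mul_div, le_div_iff₀ hc₀]
      refine le_of_mul_le_mul_right ?_ hDp
      linarith
    have h4 := Real.rpow_le_rpow (by positivity) h2 hε.le
    rw [Real.mul_rpow (by positivity) (by positivity)] at h4
    refine le_trans (le_of_eq ?_) h4
    rw [← Real.rpow_natCast, ← Real.rpow_natCast, ← Real.rpow_mul hG0.le, ← Real.rpow_mul hG0.le]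
    congr 1
    field_simp
  have hB2 : B (n + 2) ≤ 2 * E ^ (n + 2) * B (n + 1) := by
    have h1 : B n ≤ B (n + 1) := by
      have := (hn₁ n hnn).2.2.1
      nlinarith
    have h2 := hbE (n + 2) (by omega)
    have h3 : (1 : ℝ) ≤ E ^ (n + 2) := one_le_pow₀ hE
    rw [hB]
    nlinarith [mul_le_mul_of_nonneg_right h2 p1.le, mul_le_mul_of_nonneg_right h3 p1.le]
  have hQ2 : (D : ℝ) ^ (n + 2) * B (n + 2) ≤ C * N * N ^ ε := by
    calc (D : ℝ) ^ (n + 2) * B (n + 2) ≤ D ^ (n + 2) * (2 * E ^ (n + 2) * (4 * N * D ^ n)) := by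
          gcongr
          exact hB2.trans (by gcongr)
      _ ≤ D ^ (n + 2) * (2 * E ^ (n + 2) * (4 * N * D ^ (n + 1))) := by
          gcongr
          omega
      _ = 8 * D * E * N * G ^ (n + 1) := by rw [hG]; ring
      _ ≤ 8 * D * E * N * ((4 / c₀) ^ ε * (N : ℝ) ^ ε) := by gcongr
      _ = _ := by rw [hC]; ring
  have hQ1 : (D : ℝ) ^ (n + 1) * B (n + 1) ≤ C * N * N ^ ε := by
    refine le_trans ?_ hQ2
    have h1 := (hn₁ (n + 1) (by omega)).2.2.1
    have h2 : B (n + 1) ≤ B (n + 2) := by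
      rw [show n + 2 = n + 1 + 1 from rfl]; nlinarith
    gcongr
    exact one_le_two
  have hconc : (1 : ℝ) / (2 * C) / (N : ℝ) ^ (2 + ε) = 1 / (2 * N * (C * N * N ^ ε)) := by
    rw [Real.rpow_add hN0, Real.rpow_two, div_div]
    congr 1
    ring
  rw [ge_iff_le, hconc]
  have hmain : ∀ j, n₁ ≤ j → r j * (2 * N) ≤ 1 → (D : ℝ) ^ j * B j ≤ C * N * N ^ ε →
      A j * N - B j * M ≠ 0 → 1 / (2 * N * (C * N * N ^ ε)) ≤ |τ - (M : ℝ) / (N : ℝ)| := by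
    intro j hj hrj hQj hne
    obtain ⟨p, hp⟩ := hAz j
    obtain ⟨q, hq⟩ := hBz j
    have hDj : (0 : ℝ) < D ^ j := by positivity
    refine int_approx_lower_bound (p := p) (q := q) (x := r j) hNz ?_ ?_ hrj ?_ (hq ▸ hQj)
    · intro h0
      have h0' : (p : ℝ) * N - q * M = 0 := by exact_mod_cast h0
      rw [← hp, ← hq] at h0'
      have : (D : ℝ) ^ j * (A j * N - B j * M) = 0 := by linarith
      exact hne ((mul_eq_zero.mp this).resolve_left hDj.ne')
    · rw [← hp, ← hq, mul_assoc, ← mul_sub, abs_mul, abs_of_pos hDj]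
      calc (D : ℝ) ^ j * |B j * τ - A j| ≤ D ^ j * (2 / B (j + 1)) := by
            gcongr
            exact (hn₁ j hj).1
        _ = r j := by simp only [hr]; ring
    · rw [← hq]
      have := hpos j
      positivity
  by_cases hne : A (n + 1) * N - B (n + 1) * M = 0
  · refine hmain (n + 2) (by omega) hk2 hQ2 fun hne2 => ?_
    have h1 := hdet (n + 1)
    have h2 : (N : ℝ) * (-1) ^ (n + 1) = 0 := by
      rw [← h1]
      linear_combination B (n + 1) * hne2 - B (n + 2) * hne
    simp [hN0.ne'] at h2
  · exact hmain (n + 1) (by omega) hk hQ1 hne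

theorem exists_eq_of_periodic_of_one_le {c d : ℕ → ℚ} {s : ℕ} (hs : 1 ≤ s)
    (hcper : ∀ n, 1 ≤ n → c (n + s) = c n) (hdper : ∀ n, 1 ≤ n → d (n + s) = d n)
    (n : ℕ) (hn : 1 ≤ n) : ∃ i ∈ Finset.Icc 1 s, c n = c i ∧ d n = d i := by
  induction n using Nat.strong_induction_on with
  | _ n ih =>
    by_cases h : n ≤ s
    · exact ⟨n, Finset.mem_Icc.mpr ⟨hn, h⟩, rfl, rfl⟩
    · obtain ⟨i, hi, h1, h2⟩ := ih (n - s) (by omega) (by omega)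
      refine ⟨i, hi, ?_, ?_⟩
      · rw [← h1, ← hcper (n - s) (by omega), Nat.sub_add_cancel (by omega)]
      · rw [← h2, ← hdper (n - s) (by omega), Nat.sub_add_cancel (by omega)]

theorem exists_common_denominator (S : Finset ℕ) (f : ℕ → ℚ) :
    ∃ D : ℕ, 1 ≤ D ∧ ∀ i ∈ S, ∃ z : ℤ, (D : ℚ) * f i = z := by
  refine ⟨∏ i ∈ S, (f i).den, Finset.prod_pos fun i _ => (f i).pos, fun i hi => ?_⟩
  obtain ⟨k, hk⟩ := Finset.dvd_prod_of_mem (fun i => (f i).den) hi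
  refine ⟨k * (f i).num, ?_⟩
  rw [hk]
  push_cast
  rw [mul_comm ((f i).den : ℚ), mul_assoc, mul_comm ((f i).den : ℚ), Rat.mul_den_eq_num]

/-- the Bundschuh-type continued fraction
`K_{n=1}^∞ 1/(c_n + d_n ⌈n/s⌉^m)` with `s`-periodic sequences of positive
rationals `(c_n)`, `(d_n)` converges to an irrational number with asymptotic
irrationality exponent `2`. -/
theorem bundschuh_gcf_muI_eq_two
    (m s : ℕ) (hm : 1 ≤ m) (hs : 1 ≤ s)
    (c d : ℕ → ℚ) (hc : ∀ n, 1 ≤ n → 0 < c n) (hd : ∀ n, 1 ≤ n → 0 < d n)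
    (hcper : ∀ n, 1 ≤ n → c (n + s) = c n) (hdper : ∀ n, 1 ≤ n → d (n + s) = d n) :
    ∃ τ : ℝ,
      Tendsto (fun n =>
          ((cfAQ (fun _ => 1) (fun n => c n + d n * ((⌈(n : ℚ) / (s : ℚ)⌉ : ℚ)) ^ m) n : ℝ) /
           (cfBQ (fun _ => 1) (fun n => c n + d n * ((⌈(n : ℚ) / (s : ℚ)⌉ : ℚ)) ^ m) n : ℝ)))
        atTop (nhds τ) ∧
      Irrational τ ∧
      muI τ = ((2 : ℝ) : EReal) := by
  have hs0 : (0 : ℚ) < s := by exact_mod_cast hs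
  have hper := exists_eq_of_periodic_of_one_le hs hcper hdper
  set b : ℕ → ℚ := fun n => c n + d n * ((⌈(n : ℚ) / (s : ℚ)⌉ : ℚ)) ^ m with hbdef
  have hceil_le : ∀ n : ℕ, ⌈(n : ℚ) / (s : ℚ)⌉ ≤ (n : ℤ) := fun n => by
    refine Int.ceil_le.mpr ?_
    push_cast
    exact div_le_self (by positivity) (by exact_mod_cast hs)
  have hceil_pos : ∀ n : ℕ, 1 ≤ n → 1 ≤ ⌈(n : ℚ) / (s : ℚ)⌉ := fun n hn =>
    Int.one_le_ceil_iff.mpr (div_pos (by exact_mod_cast hn) hs0)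
  have hbpos : ∀ n, 1 ≤ n → 0 < b n := fun n hn => by
    have h1 : (0 : ℚ) < ⌈(n : ℚ) / (s : ℚ)⌉ := by exact_mod_cast hceil_pos n hn
    have := hc n hn
    have := hd n hn
    simp only [hbdef]
    positivity
  obtain ⟨D, hD, hbD⟩ : ∃ D : ℕ, 1 ≤ D ∧ ∀ n, 1 ≤ n → ∃ z : ℤ, (D : ℚ) * b n = z := by
    obtain ⟨D₁, hD₁, h₁⟩ := exists_common_denominator (Finset.Icc 1 s) c
    obtain ⟨D₂, hD₂, h₂⟩ := exists_common_denominator (Finset.Icc 1 s) d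
    refine ⟨D₁ * D₂, Nat.mul_pos hD₁ hD₂, fun n hn => ?_⟩
    obtain ⟨i, hi, hci, hdi⟩ := hper n hn
    obtain ⟨x, hx⟩ := h₁ i hi
    obtain ⟨y, hy⟩ := h₂ i hi
    refine ⟨D₂ * x + D₁ * y * ⌈(n : ℚ) / (s : ℚ)⌉ ^ m, ?_⟩
    simp only [hbdef, hci, hdi]
    push_cast
    rw [← hx, ← hy]
    ring
  obtain ⟨δ, hδ, hdδ⟩ : ∃ δ > (0 : ℚ), ∀ n, 1 ≤ n → δ ≤ d n := by
    obtain ⟨i, hi, hmin⟩ := (Finset.Icc 1 s).exists_min_image d ⟨1, Finset.mem_Icc.mpr ⟨le_rfl, hs⟩⟩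
    refine ⟨d i, hd i (Finset.mem_Icc.mp hi).1, fun n hn => ?_⟩
    obtain ⟨j, hj, -, hdj⟩ := hper n hn
    exact hdj ▸ hmin j hj
  obtain ⟨U, hU, hcdU⟩ : ∃ U : ℚ, 1 ≤ U ∧ ∀ n, 1 ≤ n → c n + d n ≤ U := by
    obtain ⟨i, -, hmax⟩ := (Finset.Icc 1 s).exists_max_image (fun n => c n + d n)
      ⟨1, Finset.mem_Icc.mpr ⟨le_rfl, hs⟩⟩
    refine ⟨max 1 (c i + d i), le_max_left _ _, fun n hn => ?_⟩
    obtain ⟨j, hj, hcj, hdj⟩ := hper n hn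
    rw [hcj, hdj]
    exact (hmax j hj).trans (le_max_right _ _)
  have hbE : ∀ n, 1 ≤ n → b n ≤ (U * 2 ^ m) ^ n := fun n hn => by
    have h1 : (1 : ℚ) ≤ ⌈(n : ℚ) / (s : ℚ)⌉ := by exact_mod_cast hceil_pos n hn
    have h2 : (⌈(n : ℚ) / (s : ℚ)⌉ : ℚ) ≤ 2 ^ n := by
      have : (⌈(n : ℚ) / (s : ℚ)⌉ : ℚ) ≤ n := by exact_mod_cast hceil_le n
      exact this.trans (by exact_mod_cast Nat.lt_two_pow_self.le)
    have h3 : (1 : ℚ) ≤ (⌈(n : ℚ) / (s : ℚ)⌉ : ℚ) ^ m := one_le_pow₀ h1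
    have hcn := hc n hn
    have hdn := hd n hn
    calc b n ≤ (c n + d n) * (⌈(n : ℚ) / (s : ℚ)⌉ : ℚ) ^ m := by
          simp only [hbdef]; nlinarith
      _ ≤ U * (2 ^ n) ^ m := by
          gcongr
          exact hcdU n hn
      _ ≤ U ^ n * (2 ^ n) ^ m := by
          gcongr
          exact le_self_pow₀ hU (by omega)
      _ = (U * 2 ^ m) ^ n := by rw [mul_pow, ← pow_mul, ← pow_mul, mul_comm n m]
  have hblow : ∀ n, 1 ≤ n → δ / s * n ≤ b n := fun n hn => by
    have h1 : (1 : ℚ) ≤ ⌈(n : ℚ) / (s : ℚ)⌉ := by exact_mod_cast hceil_pos n hn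
    have hcn := hc n hn
    calc δ / s * n = δ * (n / s) := by ring
      _ ≤ d n * (⌈(n : ℚ) / (s : ℚ)⌉ : ℚ) ^ m := by
          gcongr
          · exact (hd n hn).le
          · exact hdδ n hn
          · exact (Int.le_ceil _).trans (le_self_pow₀ h1 (by omega))
      _ ≤ b n := by simp only [hbdef]; linarith
  have hblim : Tendsto (fun n => (b n : ℝ)) atTop atTop := by
    have h1 : Tendsto (fun n : ℕ => ((δ / s : ℚ) : ℝ) * n) atTop atTop :=
      tendsto_natCast_atTop_atTop.const_mul_atTop (by exact_mod_cast div_pos hδ hs0)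
    refine tendsto_atTop_mono' _ ?_ h1
    filter_upwards [eventually_ge_atTop 1] with n hn
    exact_mod_cast hblow n hn
  set A : ℕ → ℝ := fun n => (cfAQ (fun _ => 1) b n : ℝ) with hAdef
  set B : ℕ → ℝ := fun n => (cfBQ (fun _ => 1) b n : ℝ) with hBdef
  have hA0 : A 0 = 0 := by simp [hAdef, cfAQ]
  have hA1 : A 1 = 1 := by simp [hAdef, cfAQ]
  have hB0 : B 0 = 1 := by simp [hBdef, cfBQ]
  have hB1 : B 1 = (b 1 : ℝ) := by simp [hBdef, cfBQ]
  have hA : ∀ n, A (n + 2) = (b (n + 2) : ℝ) * A (n + 1) + A n := fun n => by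
    simp only [hAdef, cfAQ]; push_cast; ring
  have hB : ∀ n, B (n + 2) = (b (n + 2) : ℝ) * B (n + 1) + B n := fun n => by
    simp only [hBdef, cfBQ]; push_cast; ring
  have hbD' : ∀ n, 1 ≤ n → ∃ z : ℤ, (D : ℝ) * (b n : ℝ) = z := fun n hn => by
    obtain ⟨z, hz⟩ := hbD n hn
    exact ⟨z, by exact_mod_cast hz⟩
  have hAz := exists_int_eq_pow_mul_of_recurrence (X := A) (b := fun n => (b n : ℝ)) hbD'
    ⟨0, by simp [hA0]⟩ ⟨D, by simp [hA1]⟩ hA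
  have hBz := exists_int_eq_pow_mul_of_recurrence (X := B) (b := fun n => (b n : ℝ)) hbD'
    ⟨1, by simp [hB0]⟩ (by rw [hB1]; exact hbD' 1 le_rfl) hB
  have hpos := denominators_pos (b := fun n => (b n : ℝ)) hB0 hB1 hB
    fun n hn => by exact_mod_cast hbpos n hn
  have hdet := convergents_det (b := fun n => (b n : ℝ)) hA0 hB0 hA1 hA hB
  obtain ⟨τ, hτ, happ⟩ := exists_limit_convergents hpos hdet hB hblim
  have hE : (1 : ℝ) ≤ ((U * 2 ^ m : ℚ) : ℝ) := by
    exact_mod_cast one_le_mul_of_one_le_of_one_le hU (one_le_pow₀ one_le_two)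
  have hbound : ∀ ε > (0 : ℝ), _ := fun ε hε =>
    exists_irrationality_bound hD hE hpos hdet hB hblim
      (fun n hn => by exact_mod_cast hbE n hn) hAz hBz happ hε
  obtain ⟨k, hk, N₀, hN₀, h⟩ := hbound 1 one_pos
  exact ⟨τ, hτ, irrational_of_irrationality_bound hk hN₀ h, muI_eq_two_of_forall_bound hbound⟩
end
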